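/- Define z₀ = α and z_n = f(n)·α − n for n ≥ 1. For an integer n ≥ 1, one has z_n < z_m for all integers m with 0 ≤ m < n if and only if there exist j ≥ 0 and an integer t with 1 ≤ t ≤ a_{2j+2} such that n = h_{2j} + t·h_{2j+1}. In other words, the indices at which the sequence (z_n) attains a strict new minimum are exactly the numerators of the primary and secondary convergents h_{2j} + t·h_{2j+1}. -/

import Mathlib

/-- A lattice point `(q, p)` with `0 ≤ p < P + H` lying on the positive side of the line of slope `α`
is at least as far from it as `(Q, P)`, provided `(Q, P)`, `(K, H)` is a basis of the lattice
whose members lie on opposite sides of the line. -/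
theorem le_of_unimodular_pair {α : ℝ} {Q P K H q p : ℤ} (hdet : Q * H - P * K = 1)
    (hP : 0 ≤ P) (hH : 0 < H) (hv : 0 < Q * α - P) (hw : K * α - H < 0)
    (hp : 0 ≤ p) (hpn : p < P + H) (hpos : 0 < q * α - p) :
    Q * α - P ≤ q * α - p := by
  by_contra! hlt
  obtain ⟨x, hx⟩ : ∃ x, x = q * H - p * K := ⟨_, rfl⟩
  obtain ⟨y, hy⟩ : ∃ y, y = p * Q - q * P := ⟨_, rfl⟩
  have hq : q = x * Q + y * K := by rw [hx, hy]; linear_combination (-q) * hdet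
  have hp' : p = x * P + y * H := by rw [hx, hy]; linear_combination (-p) * hdet
  have hval : (q : ℝ) * α - p = x * (Q * α - P) + y * (K * α - H) := by
    rw [hq, hp']; push_cast; ring
  rw [hval] at hlt hpos
  rcases le_or_gt x 0 with hx0 | hx0
  · have hy0 : y < 0 := by
      by_contra! hy0
      have h1 : (x : ℝ) ≤ 0 := by exact_mod_cast hx0
      have h2 : (0 : ℝ) ≤ y := by exact_mod_cast hy0
      nlinarith
    nlinarith
  · have hy0 : 0 < y := by
      by_contra! hy0
      have h1 : (1 : ℝ) ≤ x := by exact_mod_cast hx0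
      have h2 : (y : ℝ) ≤ 0 := by exact_mod_cast hy0
      nlinarith
    nlinarith

theorem irrational_and_mem_Ioo_of_gauss_iterate {α : ℝ} (hirr : Irrational α) (hα0 : 0 < α)
    (hα1 : α < 1) {a : ℕ → ℕ} {β : ℕ → ℝ} (hβ0 : β 0 = α)
    (hfloor : ∀ i, (a (i + 1) : ℤ) = ⌊1 / β i⌋)
    (hβrec : ∀ i, β (i + 1) = 1 / β i - (a (i + 1) : ℝ)) (i : ℕ) :
    Irrational (β i) ∧ 0 < β i ∧ β i < 1 := by
  induction i with
  | zero => rw [hβ0]; exact ⟨hirr, hα0, hα1⟩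
  | succ i ih =>
    have hi : Irrational (β (i + 1)) := by
      rw [hβrec, one_div]
      exact ih.1.inv.sub_natCast _
    have hfl : (a (i + 1) : ℝ) = (⌊1 / β i⌋ : ℝ) := by exact_mod_cast hfloor i
    refine ⟨hi, lt_of_le_of_ne ?_ hi.ne_zero.symm, ?_⟩
    · rw [hβrec, hfl]; linarith [Int.floor_le (1 / β i)]
    · rw [hβrec, hfl]; linarith [Int.lt_floor_add_one (1 / β i)]

/-- The signed errors `(-1) ^ i * (k i * α - h i)` of the convergents are positive. -/
theorem convergent_error_pos {α : ℝ} {a h k : ℕ → ℕ} {β : ℕ → ℝ} (hβ0 : β 0 = α)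
    (hβpos : ∀ i, 0 < β i) (hβrec : ∀ i, β (i + 1) = 1 / β i - (a (i + 1) : ℝ))
    (hh0 : h 0 = 0) (hk0 : k 0 = 1) (hh1 : h 1 = 1) (hk1 : k 1 = a 1)
    (hhrec : ∀ i, h (i + 2) = a (i + 2) * h (i + 1) + h i)
    (hkrec : ∀ i, k (i + 2) = a (i + 2) * k (i + 1) + k i) (i : ℕ) :
    0 < (-1 : ℝ) ^ i * (k i * α - h i) := by
  have hmul : ∀ i, β (i + 1) * β i = 1 - a (i + 1) * β i := fun i => by
    rw [hβrec, sub_mul, one_div, inv_mul_cancel₀ (hβpos i).ne']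
  have key : ∀ i, 0 < (-1 : ℝ) ^ i * (k i * α - h i) ∧
      (-1 : ℝ) ^ (i + 1) * (k (i + 1) * α - h (i + 1)) =
        β (i + 1) * ((-1 : ℝ) ^ i * (k i * α - h i)) := by
    intro i
    induction i with
    | zero =>
      have h0 := hmul 0
      have h1 := hβpos 0
      rw [hβ0] at h0 h1
      simp only [zero_add] at h0 ⊢
      rw [hh0, hk0, hh1, hk1]
      push_cast
      refine ⟨by linarith, by linear_combination (-1) * h0⟩
    | succ i ih =>
      refine ⟨ih.2 ▸ mul_pos (hβpos _) ih.1, ?_⟩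
      rw [hhrec, hkrec]
      push_cast
      have hm := hmul (i + 1)
      have h2 := ih.2
      simp only [pow_succ] at h2 ⊢
      linear_combination ((-1 : ℝ) ^ i * (k i * α - h i)) * (-hm) +
        (-(a (i + 2) : ℝ) - β (i + 2)) * h2
  exact (key i).1

theorem convergent_det {a h k : ℕ → ℕ}
    (hh0 : h 0 = 0) (hk0 : k 0 = 1) (hh1 : h 1 = 1)
    (hhrec : ∀ i, h (i + 2) = a (i + 2) * h (i + 1) + h i)
    (hkrec : ∀ i, k (i + 2) = a (i + 2) * k (i + 1) + k i) (i : ℕ) :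
    (k i * h (i + 1) - h i * k (i + 1) : ℤ) = (-1) ^ i := by
  induction i with
  | zero => simp [hh0, hk0, hh1]
  | succ i ih =>
    rw [hhrec, hkrec, pow_succ]
    push_cast
    linear_combination (-1) * ih

/-- Every positive integer lies in one of the half-open intervals determined by consecutive
terms of `h (2 * j) + t * h (2 * j + 1)`. -/
theorem exists_secondary_interval {a h : ℕ → ℕ} (hapos : ∀ i, 1 ≤ i → 1 ≤ a i)
    (hh0 : h 0 = 0) (hpos : ∀ i, 1 ≤ h (i + 1))
    (hhrec : ∀ i, h (i + 2) = a (i + 2) * h (i + 1) + h i) {n : ℕ} (hn : 1 ≤ n) :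
    ∃ j t : ℕ, t < a (2 * j + 2) ∧ h (2 * j) + t * h (2 * j + 1) < n ∧
      n ≤ h (2 * j) + (t + 1) * h (2 * j + 1) := by
  have hgrow : ∀ j, j ≤ h (2 * j) := by
    intro j
    induction j with
    | zero => simp
    | succ j ih =>
      have h1 := Nat.mul_le_mul (hapos (2 * j + 2) (by omega)) (hpos (2 * j))
      have h2 := hhrec (2 * j)
      rw [show 2 * (j + 1) = 2 * j + 2 by ring]
      omega
  have hex : ∃ j, n ≤ h (2 * j) := ⟨n, hgrow n⟩
  classical
  obtain ⟨j, hj⟩ : ∃ j, Nat.find hex = j + 1 := by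
    refine Nat.exists_eq_succ_of_ne_zero fun h0 => ?_
    have := Nat.find_spec hex
    rw [h0, Nat.mul_zero, hh0] at this
    omega
  have hlo : h (2 * j) < n := not_le.1 (Nat.find_min hex (by omega))
  have hhi : n ≤ h (2 * j) + a (2 * j + 2) * h (2 * j + 1) := by
    have := Nat.find_spec hex
    rw [hj, show 2 * (j + 1) = 2 * j + 2 by ring, hhrec] at this
    omega
  have hex' : ∃ s, n ≤ h (2 * j) + s * h (2 * j + 1) := ⟨_, hhi⟩
  obtain ⟨t, ht⟩ : ∃ t, Nat.find hex' = t + 1 := by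
    refine Nat.exists_eq_succ_of_ne_zero fun h0 => ?_
    have := Nat.find_spec hex'
    rw [h0] at this
    omega
  refine ⟨j, t, ?_, not_le.1 (Nat.find_min hex' (by omega)), ht ▸ Nat.find_spec hex'⟩
  have := Nat.find_min' hex' hhi
  omega

/- Context: α ∈ (0,1) irrational with simple continued fraction expansion
α = [0; a₁, a₂, …] computed by the usual algorithm (β i are the tails),
and hᵢ/kᵢ the convergents given by the standard recurrences. -/
theorem stmt_10 (α : ℝ) (hirr : Irrational α) (hα0 : 0 < α) (hα1 : α < 1)
    (a h k : ℕ → ℕ) (β : ℕ → ℝ)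
    (ha0 : a 0 = 0) (hapos : ∀ i, 1 ≤ i → 1 ≤ a i)
    (hβ0 : β 0 = α)
    (hfloor : ∀ i, (a (i + 1) : ℤ) = ⌊1 / β i⌋)
    (hβrec : ∀ i, β (i + 1) = 1 / β i - (a (i + 1) : ℝ))
    (hh0 : h 0 = 0) (hk0 : k 0 = 1) (hh1 : h 1 = 1) (hk1 : k 1 = a 1)
    (hhrec : ∀ i, h (i + 2) = a (i + 2) * h (i + 1) + h i)
    (hkrec : ∀ i, k (i + 2) = a (i + 2) * k (i + 1) + k i)
    (z : ℕ → ℝ) (hz0 : z 0 = α)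
    (hz : ∀ n : ℕ, 1 ≤ n → z n = (⌈(n : ℝ) / α⌉ : ℝ) * α - (n : ℝ)) :
    ∀ n : ℕ, 1 ≤ n →
      ((∀ m : ℕ, m < n → z n < z m) ↔
        ∃ j t : ℕ, 1 ≤ t ∧ t ≤ a (2 * j + 2) ∧ n = h (2 * j) + t * h (2 * j + 1)) := by
  have hβ := irrational_and_mem_Ioo_of_gauss_iterate hirr hα0 hα1 hβ0 hfloor hβrec
  have herr := convergent_error_pos hβ0 (fun i => (hβ i).2.1) hβrec hh0 hk0 hh1 hk1 hhrec hkrec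
  have hdet := convergent_det hh0 hk0 hh1 hhrec hkrec
  have hpos : ∀ i, 1 ≤ h (i + 1) := by
    intro i
    induction i with
    | zero => rw [hh1]
    | succ i ih =>
      have h1 := Nat.mul_le_mul (hapos (i + 2) (by omega)) ih
      have h2 := hhrec i
      rw [show i + 1 + 1 = i + 2 by ring]
      omega
  have heven : ∀ j, 0 < (k (2 * j) : ℝ) * α - h (2 * j) := fun j => by
    simpa using herr (2 * j)
  have hodd : ∀ j, (k (2 * j + 1) : ℝ) * α - h (2 * j + 1) < 0 := fun j => by
    have := herr (2 * j + 1)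
    rw [pow_succ, pow_mul] at this
    norm_num at this
    linarith
  have hzspec : ∀ m, (∃ q : ℤ, z m = q * α - m) ∧ 0 < z m ∧
      ∀ q : ℤ, 0 < q * α - m → z m ≤ q * α - m := by
    intro m
    rcases Nat.eq_zero_or_pos m with rfl | hm
    · refine ⟨⟨1, by simp [hz0]⟩, hz0 ▸ hα0, fun q hq => ?_⟩
      simp only [Nat.cast_zero, sub_zero, hz0] at hq ⊢
      have h1 : (0 : ℝ) < q := pos_of_mul_pos_left hq hα0.le
      have h2 : (1 : ℝ) ≤ q := by exact_mod_cast (by exact_mod_cast h1 : (0 : ℤ) < q)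
      nlinarith
    · rw [hz m hm]
      refine ⟨⟨_, rfl⟩, ?_, fun q hq => ?_⟩
      · have h1 : (m : ℝ) ≤ ⌈(m : ℝ) / α⌉ * α := (div_le_iff₀ hα0).1 (Int.le_ceil _)
        refine sub_pos.2 (lt_of_le_of_ne h1 fun h2 => ?_)
        have h3 : ⌈(m : ℝ) / α⌉ ≠ 0 := (Int.ceil_pos.2 (by positivity)).ne'
        exact (hirr.intCast_mul h3).ne_nat m h2.symm
      · have h1 : ⌈(m : ℝ) / α⌉ ≤ q := Int.ceil_le.2 ((div_le_iff₀ hα0).2 (sub_pos.1 hq).le)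
        have h2 : (⌈(m : ℝ) / α⌉ : ℝ) ≤ q := by exact_mod_cast h1
        nlinarith
  have hvpos : ∀ j t : ℕ, t ≤ a (2 * j + 2) → 0 < ((k (2 * j) + t * k (2 * j + 1) : ℕ) : ℝ) * α -
      (h (2 * j) + t * h (2 * j + 1) : ℕ) := by
    intro j t ht
    have h1 := heven (j + 1)
    rw [show 2 * (j + 1) = 2 * j + 2 by ring, hhrec, hkrec] at h1
    have h2 : (t : ℝ) ≤ a (2 * j + 2) := by exact_mod_cast ht
    have h3 := mul_le_mul_of_nonpos_right h2 (hodd j).le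
    push_cast at h1 ⊢
    linarith
  have hmin : ∀ j t m : ℕ, t ≤ a (2 * j + 2) → m < h (2 * j) + (t + 1) * h (2 * j + 1) →
      ((k (2 * j) + t * k (2 * j + 1) : ℕ) : ℝ) * α - (h (2 * j) + t * h (2 * j + 1) : ℕ) ≤ z m := by
    intro j t m ht hm
    obtain ⟨⟨q, hq⟩, hzpos, -⟩ := hzspec m
    have hd := hdet (2 * j)
    rw [pow_mul] at hd
    have := le_of_unimodular_pair (α := α) (Q := (k (2 * j) + t * k (2 * j + 1) : ℕ))
      (P := (h (2 * j) + t * h (2 * j + 1) : ℕ)) (K := k (2 * j + 1)) (H := h (2 * j + 1))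
      (q := q) (p := m) (by push_cast; norm_num at hd; linear_combination hd)
      (by positivity) (by exact_mod_cast hpos (2 * j)) (by exact_mod_cast hvpos j t ht)
      (by exact_mod_cast hodd j) (by positivity)
      (by rw [add_mul, one_mul, ← add_assoc] at hm; exact_mod_cast hm)
      (by rw [hq] at hzpos; exact_mod_cast hzpos)
    rw [hq]
    exact_mod_cast this
  have hzle : ∀ j t : ℕ, t ≤ a (2 * j + 2) → z (h (2 * j) + t * h (2 * j + 1)) ≤
      ((k (2 * j) + t * k (2 * j + 1) : ℕ) : ℝ) * α - (h (2 * j) + t * h (2 * j + 1) : ℕ) :=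
    fun j t ht => by
      have := (hzspec (h (2 * j) + t * h (2 * j + 1))).2.2 (k (2 * j) + t * k (2 * j + 1) : ℕ)
      rw [Int.cast_natCast] at this
      exact this (hvpos j t ht)
  intro n hn
  constructor
  · intro hrec
    obtain ⟨j, t, ht, hlo, hhi⟩ := exists_secondary_interval hapos hh0 hpos hhrec hn
    refine ⟨j, t + 1, by omega, ht, hhi.eq_of_not_lt fun hlt => ?_⟩
    exact absurd (hrec _ hlo) (not_lt.2 ((hzle j t ht.le).trans (hmin j t n ht.le hlt)))
  · rintro ⟨j, t, ht1, ht, rfl⟩ m hm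
    obtain ⟨s, rfl⟩ := Nat.exists_eq_add_of_le' ht1
    refine (hzle j (s + 1) ht).trans_lt (lt_of_lt_of_le ?_ (hmin j s m (by omega) hm))
    have := hodd j
    push_cast
    linarith
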